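/- Atomic decomposition of T¹ (Hilbert-valued instance of the paper's main theorem). Let H be a separable Hilbert space and n ≥ 1. Let f : ℝⁿ × (0,∞) → H be strongly measurable with ‖f‖_{T¹(H)} := ∫_{ℝⁿ} ( ∫_{Γ(x)} ‖f(y,t)‖² dμ(y,t) )^{1/2} dx < ∞. Then there exist a constant C depending only on n, a countable family of T¹(H) atoms (a_k) and real numbers (λ_k) such that f = Σ_k λ_k a_k μ-almost everywhere on ℝⁿ × (0,∞) (at μ-a.e. point at most one summand is nonzero) and Σ_k |λ_k| ≤ C ‖f‖_{T¹(H)}. -/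

import Mathlib

open MeasureTheory ENNReal Metric Set

noncomputable section

/-- The cone `Γ(x) = {(y,t) : ‖x - y‖ < t}` in the upper half-space `ℝⁿ × (0,∞)`,
realized as a subset of `ℝⁿ × ℝ` (membership forces `t > 0`). -/
def cone (n : ℕ) (x : EuclideanSpace ℝ (Fin n)) : Set (EuclideanSpace ℝ (Fin n) × ℝ) :=
  {p | dist x p.1 < p.2}

/-- The tent `Ê = {(y,t) : t > 0, B(y,t) ⊆ E}` over a set `E ⊆ ℝⁿ`. -/
def tent (n : ℕ) (E : Set (EuclideanSpace ℝ (Fin n))) : Set (EuclideanSpace ℝ (Fin n) × ℝ) :=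
  {p | 0 < p.2 ∧ Metric.ball p.1 p.2 ⊆ E}

/-- The measure `dμ(y,t) = dy dt / t^(n+1)` on the upper half-space. -/
def muT (n : ℕ) : Measure (EuclideanSpace ℝ (Fin n) × ℝ) :=
  (volume.restrict {p : EuclideanSpace ℝ (Fin n) × ℝ | 0 < p.2}).withDensity
    fun p => ENNReal.ofReal (p.2 ^ (-(n + 1 : ℝ)))

/-- A `T¹(H)` atom: a strongly measurable function supported in the tent over some open
ball `B` with `∫_B ∫_{Γ(x)} ‖a‖² dμ dx ≤ 1/|B|`. -/
def IsT1Atom (n : ℕ) {H : Type*} [NormedAddCommGroup H]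
    (a : EuclideanSpace ℝ (Fin n) × ℝ → H) : Prop :=
  StronglyMeasurable a ∧
  ∃ (xB : EuclideanSpace ℝ (Fin n)) (rB : ℝ), 0 < rB ∧
    (∀ p ∉ tent n (Metric.ball xB rB), a p = 0) ∧
    (∫⁻ x in Metric.ball xB rB, ∫⁻ p in cone n x, (‖a p‖₊ : ℝ≥0∞) ^ 2 ∂muT n) ≤
      1 / volume (Metric.ball xB rB)


abbrev ES (n : ℕ) := EuclideanSpace ℝ (Fin n)

instance muT_sfinite (n : ℕ) : SFinite (muT n) := by unfold muT; infer_instance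

def TT (n : ℕ) (E : Set (ES n)) : Set (ES n × ℝ) :=
  {p | 0 < p.2 ∧ volume (ball p.1 p.2) < 2 * volume (ball p.1 p.2 ∩ E)}

def STn (n : ℕ) (q : ES n × ℝ) : Set (ES n × ℝ) :=
  {p | 0 < p.2 ∧ dist p.1 q.1 + p.2 ≤ q.2}

lemma measurableSet_coneRel (n : ℕ) :
    MeasurableSet {z : (ES n × ℝ) × ES n | dist z.2 z.1.1 < z.1.2} :=
  measurableSet_lt (by fun_prop) (by fun_prop)

lemma measurable_vol (n : ℕ) {E : Set (ES n)} (hE : MeasurableSet E) :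
    Measurable fun p : ES n × ℝ => volume (ball p.1 p.2 ∩ E) := by
  have h := measurable_measure_prodMk_left (ν := (volume : Measure (ES n)))
    ((measurableSet_coneRel n).inter (measurable_snd hE))
  exact h

lemma measurableSet_TT (n : ℕ) {E : Set (ES n)} (hE : MeasurableSet E) :
    MeasurableSet (TT n E) := by
  have h1 := measurable_vol n hE
  have h0 := measurable_vol n MeasurableSet.univ
  simp only [inter_univ] at h0
  exact (measurableSet_lt measurable_const measurable_snd).inter
    (measurableSet_lt h0 (h1.const_mul 2))

lemma measurableSet_STn (n : ℕ) (q : ES n × ℝ) : MeasurableSet (STn n q) :=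
  (measurableSet_lt measurable_const measurable_snd).inter
    (measurableSet_le (f := fun p : ES n × ℝ => dist p.1 q.1 + p.2) (by fun_prop) measurable_const)

lemma STn_ball {n : ℕ} {q p : ES n × ℝ} (h : p ∈ STn n q) : ball p.1 p.2 ⊆ ball q.1 q.2 :=
  ball_subset_ball' (by have := h.2; linarith)

lemma STn_subset_tent (n : ℕ) (q : ES n × ℝ) : STn n q ⊆ tent n (ball q.1 q.2) :=
  fun _ h => ⟨h.1, STn_ball h⟩

lemma tonelli (n : ℕ) {g : ES n × ℝ → ℝ≥0∞} (hg : Measurable g) (D : Set (ES n)) :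
    ∫⁻ x in D, ∫⁻ p in cone n x, g p ∂muT n = ∫⁻ p, g p * volume (ball p.1 p.2 ∩ D) ∂muT n := by
  have hc : ∀ x, MeasurableSet (cone n x) := fun x =>
    measurableSet_lt (by fun_prop) (by fun_prop)
  have hb : MeasurableSet {z : ES n × (ES n × ℝ) | dist z.1 z.2.1 < z.2.2} :=
    measurableSet_lt (by fun_prop) (by fun_prop)
  have e1 : ∀ x, ∫⁻ p in cone n x, g p ∂muT n =
      ∫⁻ p, ({z : ES n × (ES n × ℝ) | dist z.1 z.2.1 < z.2.2}.indicator (fun z => g z.2)) (x, p)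
        ∂muT n := by
    intro x
    rw [← lintegral_indicator (hc x)]
    rfl
  simp_rw [e1]
  rw [lintegral_lintegral_swap]
  · refine lintegral_congr fun p => ?_
    have : ∀ x, ({z : ES n × (ES n × ℝ) | dist z.1 z.2.1 < z.2.2}.indicator (fun z => g z.2))
        (x, p) = (ball p.1 p.2).indicator (fun _ => g p) x := fun x => rfl
    simp_rw [this]
    rw [lintegral_indicator measurableSet_ball, lintegral_const,
      Measure.restrict_restrict measurableSet_ball, Measure.restrict_apply_univ]
  · exact ((hg.comp measurable_snd).indicator hb).aemeasurable

lemma measurable_area (n : ℕ) {g : ES n × ℝ → ℝ≥0∞} (hg : Measurable g) :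
    Measurable fun x => ∫⁻ p in cone n x, g p ∂muT n := by
  have hc : ∀ x, MeasurableSet (cone n x) := fun x =>
    measurableSet_lt (by fun_prop) (by fun_prop)
  have hb : MeasurableSet {z : ES n × (ES n × ℝ) | dist z.1 z.2.1 < z.2.2} :=
    measurableSet_lt (by fun_prop) (by fun_prop)
  have := ((hg.comp measurable_snd).indicator hb).lintegral_prod_right' (ν := muT n)
  convert this using 2 with x
  rw [← lintegral_indicator (hc x)]
  rfl

lemma vol_le_of_notMem {n : ℕ} {E : Set (ES n)} (hE : MeasurableSet E) {p : ES n × ℝ}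
    (hp : 0 < p.2) (h : p ∉ TT n E) :
    volume (ball p.1 p.2) ≤ 2 * volume (ball p.1 p.2 ∩ Eᶜ) := by
  have h1 : 2 * volume (ball p.1 p.2 ∩ E) ≤ volume (ball p.1 p.2) := by
    by_contra h2
    exact h ⟨hp, not_le.1 h2⟩
  have h2 : volume (ball p.1 p.2 ∩ E) + volume (ball p.1 p.2 ∩ Eᶜ) = volume (ball p.1 p.2) :=
    measure_inter_add_sdiff _ hE
  have hf : volume (ball p.1 p.2) ≠ ⊤ := measure_ball_lt_top.ne
  have h3 : volume (ball p.1 p.2 ∩ E) ≠ ⊤ := measure_ne_top_of_subset inter_subset_left hf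
  have h4 : volume (ball p.1 p.2 ∩ Eᶜ) ≠ ⊤ := measure_ne_top_of_subset inter_subset_left hf
  lift volume (ball p.1 p.2) to NNReal using hf with a
  lift volume (ball p.1 p.2 ∩ E) to NNReal using h3 with b
  lift volume (ball p.1 p.2 ∩ Eᶜ) to NNReal using h4 with c
  norm_cast at *
  rw [← NNReal.coe_le_coe] at *
  have := congrArg NNReal.toReal h2
  push_cast at *
  linarith

/-- Key estimate. -/
lemma key (n : ℕ) {g : ES n × ℝ → ℝ≥0∞} (hg : Measurable g) {E : Set (ES n)}
    (hE : MeasurableSet E) (M : ℝ≥0∞)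
    (hM : ∀ x ∉ E, ∫⁻ p in cone n x, g p ∂muT n ≤ M) (q : ES n × ℝ)
    {P : Set (ES n × ℝ)} (hP : MeasurableSet P) (hPq : P ⊆ STn n q) (hPE : Disjoint P (TT n E)) :
    ∫⁻ x in ball q.1 q.2, ∫⁻ p in cone n x, P.indicator g p ∂muT n
      ≤ 2 * M * volume (ball q.1 q.2) := by
  have hPg : Measurable (P.indicator g) := hg.indicator hP
  rw [tonelli n hPg]
  calc _ ≤ ∫⁻ p, 2 * (P.indicator g p * volume (ball p.1 p.2 ∩ (ball q.1 q.2 ∩ Eᶜ))) ∂muT n := by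
        refine lintegral_mono fun p => ?_
        by_cases hp : p ∈ P
        · have h1 := vol_le_of_notMem hE (hPq hp).1 (fun h => disjoint_left.1 hPE hp h)
          rw [← inter_assoc, inter_eq_left.2 (STn_ball (hPq hp))]
          calc _ ≤ P.indicator g p * (2 * volume (ball p.1 p.2 ∩ Eᶜ)) := by gcongr
            _ = _ := by ring
        · simp [hp]
    _ = 2 * ∫⁻ x in ball q.1 q.2 ∩ Eᶜ, ∫⁻ p in cone n x, P.indicator g p ∂muT n := by
        rw [lintegral_const_mul' _ _ (by simp), tonelli n hPg]
    _ ≤ 2 * ∫⁻ x in ball q.1 q.2 ∩ Eᶜ, M := by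
        gcongr 2 * ?_
        refine setLIntegral_mono measurable_const fun x hx => ?_
        refine le_trans (lintegral_mono fun p => ?_) (hM x hx.2)
        exact indicator_le_self _ _ _
    _ ≤ _ := by
        rw [setLIntegral_const, mul_assoc]
        gcongr
        exact inter_subset_left

/-- Covering. -/
lemma covering (n : ℕ) (hn : 1 ≤ n) {E : Set (ES n)} (hE : MeasurableSet E)
    (hfin : volume E ≠ ⊤) :
    ∃ F : ℕ → ES n × ℝ, (∀ m, 0 ≤ (F m).2) ∧ TT n E ⊆ ⋃ m, STn n (F m) ∧
      ∑' m, volume (ball (F m).1 (F m).2) ≤ 2 * 5 ^ n * volume E := by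
  have : Nonempty (Fin n) := ⟨⟨0, hn⟩⟩
  have : Nontrivial (ES n) := inferInstance
  have hvb : ∀ (x : ES n) {r : ℝ}, 0 ≤ r →
      volume (ball x r) = ENNReal.ofReal (r ^ n) * volume (ball (0 : ES n) 1) := by
    intro x r hr
    rw [Measure.addHaar_ball _ x hr]; simp
  have hv0 : volume (ball (0 : ES n) 1) ≠ 0 := (measure_ball_pos _ _ one_pos).ne'
  have hv1 : volume (ball (0 : ES n) 1) ≠ ⊤ := measure_ball_lt_top.ne
  set v := volume (ball (0 : ES n) 1) with hv
  obtain ⟨R, hR⟩ : ∃ R : ℝ, ∀ p ∈ TT n E, p.2 ≤ R := by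
    refine ⟨max 1 (2 * volume E / v).toReal, fun p hp => ?_⟩
    by_cases h1 : p.2 ≤ 1
    · exact le_max_of_le_left h1
    push Not at h1
    refine le_max_of_le_right ?_
    have hp2 := hp.2
    rw [hvb _ hp.1.le] at hp2
    have h3 : ENNReal.ofReal (p.2 ^ n) ≤ 2 * volume E / v := by
      rw [ENNReal.le_div_iff_mul_le (Or.inl hv0) (Or.inl hv1)]
      refine hp2.le.trans ?_
      gcongr
      exact inter_subset_right
    have h4 : 2 * volume E / v ≠ ⊤ := ENNReal.div_ne_top (ENNReal.mul_ne_top (by simp) hfin) hv0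
    have h5 := (ENNReal.ofReal_le_iff_le_toReal h4).1 h3
    exact (le_self_pow₀ h1.le (by omega)).trans h5
  obtain ⟨u, hut, hud, hu⟩ := Vitali.exists_disjoint_subfamily_covering_enlargement
    (fun p : ES n × ℝ => ball p.1 p.2) (TT n E) (fun p => p.2) 2 (by norm_num)
    (fun p hp => hp.1.le) R hR (fun p hp => nonempty_ball.2 hp.1)
  have huc : u.Countable := hud.countable_of_isOpen (fun _ _ => isOpen_ball)
    (fun p hp => nonempty_ball.2 (hut hp).1)
  have : Countable u := huc
  obtain ⟨e, he⟩ := exists_injective_nat u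
  set F : ℕ → ES n × ℝ := Function.extend e (fun p : u => ((p : ES n × ℝ).1, 5 * (p : ES n × ℝ).2))
    (fun _ => 0) with hF
  have hF1 : ∀ p : u, F (e p) = ((p : ES n × ℝ).1, 5 * (p : ES n × ℝ).2) := fun p =>
    he.extend_apply _ _ _
  have hF2 : ∀ m, m ∉ range e → F m = 0 := fun m hm =>
    Function.extend_apply' _ _ _ (by simpa using hm)
  refine ⟨F, ?_, ?_, ?_⟩
  · intro m
    by_cases hm : m ∈ range e
    · obtain ⟨p, rfl⟩ := hm
      rw [hF1]
      have := (hut p.2).1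
      dsimp only; linarith
    · rw [hF2 m hm]; simp
  · intro p hp
    obtain ⟨b, hb, ⟨z, hz1, hz2⟩, hpb⟩ := hu p hp
    refine mem_iUnion.2 ⟨e ⟨b, hb⟩, ?_⟩
    rw [hF1]
    refine ⟨hp.1, ?_⟩
    have := dist_triangle_left p.1 b.1 z
    simp only [mem_ball] at hz1 hz2
    dsimp only at *; linarith
  · have h1 : ∑' m, volume (ball (F m).1 (F m).2) =
        ∑' p : u, volume (ball (p : ES n × ℝ).1 (5 * (p : ES n × ℝ).2)) := by
      rw [← tsum_extend_zero he]
      congr 1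
      funext m
      by_cases hm : m ∈ range e
      · obtain ⟨p, rfl⟩ := hm
        rw [hF1, he.extend_apply]
      · rw [hF2 m hm, Function.extend_apply' _ _ _ (by simpa using hm)]; simp
    rw [h1]
    calc _ ≤ ∑' p : u, 2 * 5 ^ n * volume (ball (p : ES n × ℝ).1 (p : ES n × ℝ).2 ∩ E) := by
          refine ENNReal.tsum_le_tsum fun p => ?_
          have hp := hut p.2
          have h5 := hp.2
          rw [hvb _ (by have := hp.1; linarith), mul_pow, ENNReal.ofReal_mul (by positivity),
            mul_assoc, ← hvb (p : ES n × ℝ).1 hp.1.le, ENNReal.ofReal_pow (by norm_num)]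
          calc _ ≤ ENNReal.ofReal 5 ^ n * (2 * volume (ball (p : ES n × ℝ).1 (p : ES n × ℝ).2 ∩ E)) := by
                gcongr
            _ = _ := by
                rw [show ENNReal.ofReal 5 = 5 by simp]; ring
      _ = 2 * 5 ^ n * ∑' p : u, volume (ball (p : ES n × ℝ).1 (p : ES n × ℝ).2 ∩ E) :=
          ENNReal.tsum_mul_left
      _ ≤ _ := by
          gcongr
          refine (tsum_meas_le_meas_iUnion_of_disjoint volume
            (As := fun p : u => ball (p : ES n × ℝ).1 (p : ES n × ℝ).2 ∩ E)
            (fun p => measurableSet_ball.inter hE) ?_).trans (measure_mono ?_)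
          · intro a b hab
            have := hud a.2 b.2 (fun h => hab (Subtype.ext h))
            exact this.mono inter_subset_left inter_subset_left
          · exact iUnion_subset fun _ => inter_subset_right

lemma dyadic_sum (s : ℝ≥0∞) :
    ∑' k : ℤ, (if (2 : ℝ≥0∞) ^ k < s then (2 : ℝ≥0∞) ^ k else 0) ≤ 2 * s := by
  rcases eq_or_ne s 0 with rfl | h0
  · simp
  rcases eq_or_ne s ⊤ with rfl | ht
  · simp
  obtain ⟨k0, hk1, hk2⟩ := ENNReal.exists_mem_Ioc_zpow h0 ht (y := 2) (by norm_num) (by norm_num)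
  have hle : ∀ k : ℤ, (if (2 : ℝ≥0∞) ^ k < s then (2 : ℝ≥0∞) ^ k else 0) ≤
      Function.extend (fun m : ℕ => k0 - m) (fun m : ℕ => (2 : ℝ≥0∞) ^ k0 * (2⁻¹) ^ m) 0 k := by
    intro k
    split_ifs with h
    · have h1 : k < k0 + 1 := by
        by_contra hc
        exact absurd (h.trans_le hk2) (not_lt.2 (ENNReal.zpow_le_of_le (by norm_num) (not_lt.1 hc)))
      obtain ⟨m, hm⟩ : ∃ m : ℕ, k = k0 - m := ⟨(k0 - k).toNat, by omega⟩
      have hinj : Function.Injective (fun m : ℕ => k0 - (m : ℤ)) := fun a b h => by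
        simp only at h; omega
      have := hinj.extend_apply (fun m : ℕ => (2 : ℝ≥0∞) ^ k0 * (2⁻¹) ^ m) 0 m
      rw [hm, this, sub_eq_add_neg, ENNReal.zpow_add (by norm_num) (by norm_num), ENNReal.zpow_neg,
        zpow_natCast, ENNReal.inv_pow]
    · exact zero_le
  calc _ ≤ _ := ENNReal.tsum_le_tsum hle
    _ = 2 ^ k0 * 2 := by
        have hinj : Function.Injective (fun m : ℕ => k0 - (m : ℤ)) := fun a b h => by
          simp only at h; omega
        rw [tsum_extend_zero hinj, ENNReal.tsum_mul_left,
          ENNReal.tsum_geometric, ENNReal.one_sub_inv_two, inv_inv]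
    _ ≤ _ := by rw [mul_comm]; gcongr

/-- Atoms. -/
lemma atom_of (n : ℕ) {H : Type} [NormedAddCommGroup H] [InnerProductSpace ℝ H]
    {f : ES n × ℝ → H} (hf : StronglyMeasurable f) {E : Set (ES n)}
    (hE : MeasurableSet E) (w : ℝ≥0∞) (hw0 : w ≠ 0) (hwt : w ≠ ⊤)
    (hM : ∀ x ∉ E, ∫⁻ p in cone n x, (‖f p‖₊ : ℝ≥0∞) ^ 2 ∂muT n ≤ w ^ 2) (q : ES n × ℝ)
    {P : Set (ES n × ℝ)} (hP : MeasurableSet P) (hPq : P ⊆ STn n q) (hPE : Disjoint P (TT n E)) :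
    IsT1Atom n (fun p => ((2 * w * volume (ball q.1 q.2)).toReal)⁻¹ • P.indicator f p) := by
  have hV : volume (ball q.1 q.2) ≠ ⊤ := measure_ball_lt_top.ne
  refine ⟨(hf.indicator hP).const_smul _, ?_⟩
  rcases le_or_gt q.2 0 with hq | hq
  · refine ⟨0, 1, one_pos, ?_, ?_⟩
    · intro p hp; simp [ball_eq_empty.2 hq]
    · simp [ball_eq_empty.2 hq]
  · have hV0 : volume (ball q.1 q.2) ≠ 0 := (measure_ball_pos _ _ hq).ne'
    refine ⟨q.1, q.2, hq, ?_, ?_⟩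
    · intro p hp
      dsimp only
      rw [indicator_of_notMem (fun h => hp (STn_subset_tent n q (hPq h))), smul_zero]
    · have hg : Measurable fun p => (‖f p‖₊ : ℝ≥0∞) ^ 2 := by
        have := hf.nnnorm.measurable
        fun_prop
      have hk := key n hg hE (w ^ 2) hM q hP hPq hPE
      set V := volume (ball q.1 q.2) with hVd
      set L := 2 * w * V with hL
      have hLt : L ≠ ⊤ := by finiteness
      have hL0 : L ≠ 0 := by simp [hL, hw0, hV0]
      have hn : (‖(L.toReal)⁻¹‖₊ : ℝ≥0∞) = L⁻¹ := by
        rw [← enorm_eq_nnnorm, Real.enorm_eq_ofReal (by positivity), ← ENNReal.toReal_inv,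
          ENNReal.ofReal_toReal (by simp [hL0])]
      have e : ∀ p, (‖L.toReal⁻¹ • P.indicator f p‖₊ : ℝ≥0∞) ^ 2 =
          (L⁻¹) ^ 2 * P.indicator (fun p => (‖f p‖₊ : ℝ≥0∞) ^ 2) p := by
        intro p
        rw [nnnorm_smul, ENNReal.coe_mul, hn, mul_pow]
        by_cases hp : p ∈ P <;> simp [hp]
      simp_rw [e]
      have hc : (L⁻¹) ^ 2 ≠ ⊤ := by simp [hL0]
      simp_rw [lintegral_const_mul' _ _ hc]
      calc _ ≤ L⁻¹ ^ 2 * (2 * w ^ 2 * V) := by gcongr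
        _ ≤ 1 / V := by
          rw [ENNReal.le_div_iff_mul_le (Or.inl hV0) (Or.inl hV)]
          calc _ = L⁻¹ ^ 2 * (2 * w ^ 2 * V * V) := by ring
            _ ≤ L⁻¹ ^ 2 * L ^ 2 := by
              gcongr
              calc _ ≤ 2 * (2 * w ^ 2 * V * V) := by
                    nth_rewrite 1 [← one_mul (2 * w ^ 2 * V * V)]
                    gcongr; norm_num
                _ = _ := by rw [hL]; ring
            _ = 1 := by rw [← mul_pow, ENNReal.inv_mul_cancel hL0 hLt, one_pow]

lemma core (n : ℕ) (hn : 1 ≤ n) (H : Type) [NormedAddCommGroup H] [InnerProductSpace ℝ H]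
    (f : ES n × ℝ → H) (hf : StronglyMeasurable f)
    (hfin : (∫⁻ x, (∫⁻ p in cone n x, (‖f p‖₊ : ℝ≥0∞) ^ 2 ∂muT n) ^ (1/2 : ℝ)) < ⊤) :
    ∃ (a : ℤ × ℕ → ES n × ℝ → H) (lam : ℤ × ℕ → ℝ),
      (∀ k, IsT1Atom n (a k)) ∧
      (∀ᵐ p ∂muT n, {k | lam k • a k p ≠ 0}.Subsingleton ∧
        f p = ∑' k, lam k • a k p) ∧
      (∑' k, (‖lam k‖₊ : ℝ≥0∞)) ≤
        (16 * 5 ^ n) *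
          ∫⁻ x, (∫⁻ p in cone n x, (‖f p‖₊ : ℝ≥0∞) ^ 2 ∂muT n) ^ (1/2 : ℝ) := by
  have hg : Measurable fun p => (‖f p‖₊ : ℝ≥0∞) ^ 2 := by
    have := hf.nnnorm.measurable
    fun_prop
  have hFm := measurable_area n hg
  have hFm2 : Measurable fun x => (∫⁻ p in cone n x, (‖f p‖₊ : ℝ≥0∞) ^ 2 ∂muT n) ^ (1/2 : ℝ) :=
    hFm.pow_const _
  set A : ES n → ℝ≥0∞ := fun x => (∫⁻ p in cone n x, (‖f p‖₊ : ℝ≥0∞) ^ 2 ∂muT n) ^ (1/2 : ℝ)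
    with hA
  have hA2 : ∀ x, A x ^ 2 = ∫⁻ p in cone n x, (‖f p‖₊ : ℝ≥0∞) ^ 2 ∂muT n := by
    intro x
    rw [hA, ← ENNReal.rpow_natCast, ← ENNReal.rpow_mul]; norm_num
  set N := ∫⁻ x, A x with hN
  have z0 : ∀ k : ℤ, (2 : ℝ≥0∞) ^ k ≠ 0 := fun k => (ENNReal.zpow_pos (by norm_num) (by norm_num) k).ne'
  have zt : ∀ k : ℤ, (2 : ℝ≥0∞) ^ k ≠ ⊤ := fun k => ENNReal.zpow_ne_top (by norm_num) (by norm_num) k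
  have zm : ∀ {k l : ℤ}, k ≤ l → (2 : ℝ≥0∞) ^ k ≤ 2 ^ l := fun h =>
    ENNReal.zpow_le_of_le (by norm_num) h
  set E : ℤ → Set (ES n) := fun k => {x | (2 : ℝ≥0∞) ^ k < A x} with hEd
  have hE : ∀ k, MeasurableSet (E k) := fun k => measurableSet_lt measurable_const hFm2
  have hEanti : ∀ {k l : ℤ}, k ≤ l → E l ⊆ E k := fun h x hx => (zm h).trans_lt hx
  have hEv : ∀ k, 2 ^ k * volume (E k) ≤ N := fun k =>
    (mul_le_mul_right (measure_mono (fun x (hx : 2 ^ k < A x) => hx.le :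
      E k ⊆ {x | 2 ^ k ≤ A x})) (2 ^ k)).trans (mul_meas_ge_le_lintegral hFm2 (2 ^ k))
  have hEfin : ∀ k, volume (E k) ≠ ⊤ := by
    intro k h
    have := hEv k
    rw [h, ENNReal.mul_top (z0 k)] at this
    exact absurd hfin (not_lt.2 this)
  choose F hF0 hFc hFs using fun k => covering n hn (hE k) (hEfin k)
  have hTanti : ∀ {k l : ℤ}, k ≤ l → TT n (E l) ⊆ TT n (E k) := by
    intro k l h p hp
    refine ⟨hp.1, hp.2.trans_le ?_⟩
    gcongr
    exact hEanti h
  set P : ℤ × ℕ → Set (ES n × ℝ) := fun i =>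
    (TT n (E i.1) \ TT n (E (i.1 + 1))) ∩ disjointed (fun j => STn n (F i.1 j)) i.2 with hP
  have hPm : ∀ i, MeasurableSet (P i) := fun i =>
    ((measurableSet_TT n (hE _)).diff (measurableSet_TT n (hE _))).inter
      (MeasurableSet.disjointed (fun j => measurableSet_STn n _) _)
  have hPS : ∀ i, P i ⊆ STn n (F i.1 i.2) := fun i p hp => disjointed_subset (fun j => STn n (F i.1 j)) i.2 hp.2
  have hPd : ∀ i j p, p ∈ P i → p ∈ P j → i = j := by
    rintro ⟨k, i⟩ ⟨l, j⟩ p h1 h2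
    have hkl : k = l := by
      rcases lt_trichotomy k l with h | h | h
      · exact absurd (hTanti (show k + 1 ≤ l by omega) h2.1.1) h1.1.2
      · exact h
      · exact absurd (hTanti (show l + 1 ≤ k by omega) h1.1.1) h2.1.2
    subst hkl
    have hij : i = j := by
      by_contra hc
      exact disjoint_left.1 (disjoint_disjointed (fun j => STn n (F k j)) hc) h1.2 h2.2
    rw [hij]
  set L : ℤ × ℕ → ℝ≥0∞ := fun i => 2 * 2 ^ (i.1 + 1) * volume (ball (F i.1 i.2).1 (F i.1 i.2).2)
    with hL
  have hLt : ∀ i, L i ≠ ⊤ := fun i =>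
    ENNReal.mul_ne_top (ENNReal.mul_ne_top (by norm_num) (zt _)) measure_ball_lt_top.ne
  have hsm : ∀ i p, (L i).toReal • ((L i).toReal⁻¹ • (P i).indicator f p) = (P i).indicator f p := by
    intro i p
    by_cases hp : p ∈ P i
    · have hs := hPS i hp
      have hr : 0 < (F i.1 i.2).2 := by
        have := hs.1; have := hs.2; have := dist_nonneg (x := p.1) (y := (F i.1 i.2).1)
        linarith
      have : (L i) ≠ 0 := by
        simp only [hL]
        exact mul_ne_zero (mul_ne_zero (by norm_num) (z0 _)) (measure_ball_pos _ _ hr).ne'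
      rw [smul_inv_smul₀ (ENNReal.toReal_ne_zero.2 ⟨this, hLt i⟩)]
    · simp [hp]
  refine ⟨fun i p => (L i).toReal⁻¹ • (P i).indicator f p, fun i => (L i).toReal, ?_, ?_, ?_⟩
  · intro i
    refine atom_of n hf (hE (i.1 + 1)) (2 ^ (i.1 + 1)) (z0 _) (zt _) ?_ (F i.1 i.2) (hPm i) (hPS i) ?_
    · intro x hx
      rw [← hA2]
      have : A x ≤ 2 ^ (i.1 + 1) := not_lt.1 hx
      gcongr
    · exact disjoint_left.2 fun p hp => hp.1.2
  · have hpos : ∀ᵐ p ∂muT n, 0 < p.2 := by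
      unfold muT
      refine (withDensity_absolutelyContinuous _ _).ae_le ?_
      exact ae_restrict_mem (measurableSet_lt measurable_const measurable_snd)
    have hZ : ∀ᵐ p ∂muT n, (‖f p‖₊ : ℝ≥0∞) ^ 2 * volume (ball p.1 p.2 ∩ {x | A x = 0}) = 0 := by
      have hZm : MeasurableSet {x | A x = 0} := hFm2 (measurableSet_singleton 0)
      have h1 := tonelli n hg {x | A x = 0}
      have h2 : ∫⁻ x in {x | A x = 0}, ∫⁻ p in cone n x, (‖f p‖₊ : ℝ≥0∞) ^ 2 ∂muT n = 0 := by
        rw [setLIntegral_congr_fun (g := fun _ => 0) hZm]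
        · simp
        · intro x hx
          have hx : A x = 0 := hx
          simp only [← hA2, hx]; simp
      rw [h2] at h1
      exact (lintegral_eq_zero_iff (hg.mul (measurable_vol n hZm))).1 h1.symm
    filter_upwards [hpos, hZ] with p hp hpZ
    simp_rw [hsm]
    have hsub : {k | (P k).indicator f p ≠ 0}.Subsingleton := by
      intro i hi j hj
      exact hPd i j p (mem_of_indicator_ne_zero hi) (mem_of_indicator_ne_zero hj)
    refine ⟨hsub, ?_⟩
    by_cases hf0 : f p = 0
    · have : ∀ i, (P i).indicator f p = 0 := fun i => by
        by_cases h : p ∈ P i <;> simp [h, hf0]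
      simp [this, hf0]
    have hvpos : 0 < volume (ball p.1 p.2) := measure_ball_pos _ _ hp
    have hvt : volume (ball p.1 p.2) ≠ ⊤ := measure_ball_lt_top.ne
    have hvZ : volume (ball p.1 p.2 ∩ {x | A x = 0}) = 0 := by
      simpa [hf0] using hpZ
    -- some `k` with `p ∈ T_k`
    have hex : ∃ k, p ∈ TT n (E k) := by
      by_contra hc
      push Not at hc
      have h1 : ∀ k, volume (ball p.1 p.2 ∩ E k) ≤ volume (ball p.1 p.2) / 2 := by
        intro k
        rw [ENNReal.le_div_iff_mul_le (by simp) (by simp), mul_comm]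
        by_contra h2
        exact hc k ⟨hp, not_le.1 h2⟩
      have h2 : ball p.1 p.2 ⊆ (⋃ m : ℕ, ball p.1 p.2 ∩ E (-m)) ∪ (ball p.1 p.2 ∩ {x | A x = 0}) := by
        intro x hx
        by_cases h0 : A x = 0
        · exact Or.inr ⟨hx, h0⟩
        · left
          obtain ⟨m, hm⟩ := ENNReal.exists_inv_two_pow_lt h0
          refine mem_iUnion.2 ⟨m, hx, ?_⟩
          change (2 : ℝ≥0∞) ^ (-(m : ℤ)) < A x
          rwa [ENNReal.zpow_neg, zpow_natCast, ENNReal.inv_pow]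
      have h3 : volume (⋃ m : ℕ, ball p.1 p.2 ∩ E (-m)) ≤ volume (ball p.1 p.2) / 2 := by
        have hmono : Monotone fun m : ℕ => ball p.1 p.2 ∩ E (-(m : ℤ)) := by
          intro a b hab
          exact inter_subset_inter_right _ (hEanti (by omega))
        rw [hmono.directed_le.measure_iUnion]
        exact iSup_le fun m => h1 _
      have h4 := (measure_mono (μ := volume) h2).trans (measure_union_le _ _)
      rw [hvZ, add_zero] at h4
      exact absurd (h4.trans h3) (not_le.2 (ENNReal.half_lt_self hvpos.ne' hvt))
    have hbd : ∃ b : ℤ, ∀ k, p ∈ TT n (E k) → k ≤ b := by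
      have h0 : volume (ball p.1 p.2) / (2 * N + 1) ≠ 0 := by
        refine (ENNReal.div_pos hvpos.ne' ?_).ne'
        have := hfin.ne
        finiteness
      obtain ⟨m, hm⟩ := ENNReal.exists_inv_two_pow_lt h0
      refine ⟨m, fun k hk => ?_⟩
      by_contra hc
      have h1 := (hTanti (show (m : ℤ) ≤ k by omega) hk).2
      have h2 := hEv m
      rw [zpow_natCast] at h2
      have h3 : volume (ball p.1 p.2) ≤ 2 * ((2⁻¹) ^ m * N) := by
        refine h1.le.trans ?_
        gcongr
        refine (measure_mono inter_subset_right).trans ?_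
        rw [← ENNReal.inv_pow, ← ENNReal.mul_le_iff_le_inv (by simp) (by simp)]
        exact h2
      have hNt := hfin.ne
      rw [ENNReal.lt_div_iff_mul_lt (by simp) (by left; finiteness)] at hm
      refine absurd (h3.trans ?_) (not_le.2 hm)
      calc _ = (2⁻¹) ^ m * (2 * N) := by ring
        _ ≤ _ := by gcongr; exact le_self_add
    obtain ⟨k, hk, hkm⟩ := Int.exists_greatest_of_bdd hbd hex
    have hk1 : p ∉ TT n (E (k + 1)) := fun h => by have := hkm _ h; omega
    have hj := hFc k hk
    rw [← iUnion_disjointed] at hj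
    obtain ⟨j, hj⟩ := mem_iUnion.1 hj
    have hpP : p ∈ P (k, j) := ⟨⟨hk, hk1⟩, hj⟩
    rw [tsum_eq_single (k, j), indicator_of_mem hpP]
    intro i hi
    exact indicator_of_notMem (fun h => hi (hPd _ _ p h hpP)) _
  · have e1 : ∀ i, (‖(L i).toReal‖₊ : ℝ≥0∞) = L i := by
      intro i
      rw [← enorm_eq_nnnorm, Real.enorm_eq_ofReal (by positivity), ENNReal.ofReal_toReal (hLt i)]
    simp_rw [e1]
    rw [ENNReal.tsum_prod (f := fun k j => L (k, j))]
    calc ∑' (k : ℤ) (j : ℕ), L (k, j)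
        = ∑' k : ℤ, 2 * 2 ^ (k + 1) * ∑' j, volume (ball (F k j).1 (F k j).2) := by
          refine tsum_congr fun k => ?_
          simp only [hL]
          rw [ENNReal.tsum_mul_left]
      _ ≤ ∑' k : ℤ, 8 * 5 ^ n * (2 ^ k * volume (E k)) := by
          refine ENNReal.tsum_le_tsum fun k => ?_
          calc _ ≤ 2 * 2 ^ (k + 1) * (2 * 5 ^ n * volume (E k)) := by
                gcongr; exact hFs k
            _ = _ := by
                rw [ENNReal.zpow_add (by norm_num) (by norm_num), zpow_one]; ring
      _ = 8 * 5 ^ n * ∫⁻ x, ∑' k : ℤ, (if (2 : ℝ≥0∞) ^ k < A x then (2 : ℝ≥0∞) ^ k else 0) := by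
          rw [ENNReal.tsum_mul_left, lintegral_tsum]
          · congr 2
            funext k
            have : (fun x => if (2 : ℝ≥0∞) ^ k < A x then (2 : ℝ≥0∞) ^ k else 0) =
              (E k).indicator (fun _ => (2 : ℝ≥0∞) ^ k) := by
              funext x
              by_cases h : (2 : ℝ≥0∞) ^ k < A x <;> simp [hEd, h]
            rw [this, lintegral_indicator (hE k), setLIntegral_const]
          · intro k
            exact (Measurable.ite (hE k) measurable_const measurable_const).aemeasurable
      _ ≤ 8 * 5 ^ n * ∫⁻ x, 2 * A x := by
          gcongr with x
          exact dyadic_sum _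
      _ = _ := by
          rw [lintegral_const_mul' _ _ (by norm_num)]; ring

/-- Atomic decomposition of `T¹(H)` for a separable Hilbert space `H`: every strongly
measurable `f` with finite `T¹(H)` norm is, μ-a.e., a sum `∑ λₖ aₖ` of multiples of atoms
(with at most one summand nonzero at μ-a.e. point) and `∑ |λₖ| ≤ C ‖f‖_{T¹(H)}`, where `C`
depends only on `n`. -/
theorem atomic_decomposition (n : ℕ) (hn : 1 ≤ n) :
    ∃ C : ℝ≥0∞, 0 < C ∧ C < ⊤ ∧
      ∀ (H : Type) [NormedAddCommGroup H] [InnerProductSpace ℝ H] [CompleteSpace H]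
        [TopologicalSpace.SeparableSpace H]
        (f : EuclideanSpace ℝ (Fin n) × ℝ → H), StronglyMeasurable f →
        (∫⁻ x, (∫⁻ p in cone n x, (‖f p‖₊ : ℝ≥0∞) ^ 2 ∂muT n) ^ (1/2 : ℝ)) < ⊤ →
        ∃ (a : ℕ → EuclideanSpace ℝ (Fin n) × ℝ → H) (lam : ℕ → ℝ),
          (∀ k, IsT1Atom n (a k)) ∧
          (∀ᵐ p ∂muT n, {k | lam k • a k p ≠ 0}.Subsingleton ∧
            f p = ∑' k, lam k • a k p) ∧
          (∑' k, (‖lam k‖₊ : ℝ≥0∞)) ≤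
            C * ∫⁻ x, (∫⁻ p in cone n x, (‖f p‖₊ : ℝ≥0∞) ^ 2 ∂muT n) ^ (1/2 : ℝ) := by

  refine ⟨16 * 5 ^ n, by positivity, by finiteness, ?_⟩
  intro H _ _ _ _ f hf hfin
  obtain ⟨a, lam, h1, h2, h3⟩ := core n hn H f hf hfin
  have e : ℕ ≃ ℤ × ℕ := (Denumerable.eqv (ℤ × ℕ)).symm
  refine ⟨fun k => a (e k), fun k => lam (e k), fun k => h1 _, ?_, ?_⟩
  · filter_upwards [h2] with p hp
    refine ⟨fun i hi j hj => e.injective (hp.1 hi hj), ?_⟩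
    rw [hp.2]
    exact (e.tsum_eq (fun i => lam i • a i p)).symm
  · rw [e.tsum_eq (fun i => (‖lam i‖₊ : ℝ≥0∞))]
    exact h3
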